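/- Let γ > 0 and let u₀ : ℝ → ℝ be a twice continuously differentiable 1-periodic function with ∫₀¹ u₀(x) dx = 0. If ∫₀¹ (u₀'(x))³ dx < −((3γ/2) ‖u₀‖_{L²})^{3/2}, then wave breaking occurs in finite time: every periodic classical solution u of the Ostrovsky–Hunter equation on [0,T) with u(0,·) = u₀ and with u_x bounded from below on [0,T) × ℝ has T < ∞. -/

import Mathlib

open MeasureTheory Filter Set intervalIntegral

/-- A periodic (period `1` in `x`) classical solution of the Ostrovsky–Hunter
equation `(u_t + u u_x)_x = γ u` on the set `S` of times (typically `[0,T)`):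
`u` is `1`-periodic in `x`, continuously differentiable in `t`, twice
continuously differentiable in `x`, with `u_tx` continuous, and the expanded
equation `u_tx + u_x² + u u_xx = γ u` holds pointwise at positive times of `S`. -/
structure IsPeriodicOHSolution (γ : ℝ) (S : Set ℝ) (u : ℝ → ℝ → ℝ) : Prop where
  periodic : ∀ t ∈ S, ∀ x : ℝ, u t (x + 1) = u t x
  diff_t : ∀ t ∈ S, ∀ x : ℝ, DifferentiableAt ℝ (fun s => u s x) t
  diff_x : ∀ t ∈ S, ∀ x : ℝ, DifferentiableAt ℝ (u t) x
  diff_xx : ∀ t ∈ S, ∀ x : ℝ, DifferentiableAt ℝ (deriv (u t)) x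
  diff_tx : ∀ t ∈ S, ∀ x : ℝ, DifferentiableAt ℝ (fun y => deriv (fun s => u s y) t) x
  cont_u : ContinuousOn (fun p : ℝ × ℝ => u p.1 p.2) (S ×ˢ (Set.univ : Set ℝ))
  cont_ut : ContinuousOn (fun p : ℝ × ℝ => deriv (fun s => u s p.2) p.1)
      (S ×ˢ (Set.univ : Set ℝ))
  cont_ux : ContinuousOn (fun p : ℝ × ℝ => deriv (u p.1) p.2) (S ×ˢ (Set.univ : Set ℝ))
  cont_uxx : ContinuousOn (fun p : ℝ × ℝ => deriv (deriv (u p.1)) p.2)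
      (S ×ˢ (Set.univ : Set ℝ))
  cont_utx : ContinuousOn (fun p : ℝ × ℝ => deriv (fun y => deriv (fun s => u s y) p.1) p.2)
      (S ×ˢ (Set.univ : Set ℝ))
  eqn : ∀ t ∈ S, 0 < t → ∀ x : ℝ,
    deriv (fun y => deriv (fun s => u s y) t) x
      + (deriv (u t) x) ^ 2 + u t x * deriv (deriv (u t)) x = γ * u t x

open Topology

/-- Continuity of the extension by the value at time zero. -/
lemma oh_ext {G : ℝ → ℝ → ℝ}
    (hG : ContinuousOn (fun p : ℝ × ℝ => G p.1 p.2) (Set.Ici (0:ℝ) ×ˢ (Set.univ : Set ℝ))) :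
    Continuous (fun p : ℝ × ℝ => G (max p.1 0) p.2) := by
  have h2 : Continuous (fun p : ℝ × ℝ => ((max p.1 0, p.2) : ℝ × ℝ)) := by fun_prop
  exact hG.comp_continuous h2 (fun p => by simp)

lemma oh_slice {G : ℝ → ℝ → ℝ}
    (hG : ContinuousOn (fun p : ℝ × ℝ => G p.1 p.2) (Set.Ici (0:ℝ) ×ˢ (Set.univ : Set ℝ)))
    {t : ℝ} (ht : 0 ≤ t) : Continuous (G t) := by
  have h2 : Continuous (fun x : ℝ => ((t, x) : ℝ × ℝ)) := by fun_prop
  exact hG.comp_continuous h2 (fun p => by simpa using ht)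

/-- Differentiation under the integral sign for jointly continuous integrands. -/
lemma oh_param {F F' : ℝ → ℝ → ℝ} (hF : Continuous (fun p : ℝ × ℝ => F p.1 p.2))
    (hF' : Continuous (fun p : ℝ × ℝ => F' p.1 p.2)) {p₀ a b : ℝ} {s : Set ℝ} (hs : s ∈ 𝓝 p₀)
    (hd : ∀ y ∈ Set.uIcc a b, ∀ p ∈ s, HasDerivAt (fun q => F q y) (F' p y) p) :
    HasDerivAt (fun p => ∫ y in a..b, F p y) (∫ y in a..b, F' p₀ y) p₀ := by
  have hcp : IsCompact (Set.Icc (p₀ - 1) (p₀ + 1) ×ˢ Set.uIcc a b) :=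
    isCompact_Icc.prod isCompact_uIcc
  obtain ⟨C, hC⟩ := hcp.exists_bound_of_continuousOn hF'.continuousOn
  have hFs : ∀ p, Continuous (F p) := fun p => hF.comp (by fun_prop : Continuous fun y : ℝ => (p, y))
  have hFs' : ∀ p, Continuous (F' p) :=
    fun p => hF'.comp (by fun_prop : Continuous fun y : ℝ => (p, y))
  have hs2 : s ∩ Set.Icc (p₀ - 1) (p₀ + 1) ∈ 𝓝 p₀ :=
    Filter.inter_mem hs (Icc_mem_nhds (by linarith) (by linarith))
  refine (intervalIntegral.hasDerivAt_integral_of_dominated_loc_of_deriv_le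
    (bound := fun _ => C) hs2 ?_ ?_ ?_ ?_ ?_ ?_).2
  · exact Filter.Eventually.of_forall fun p => (hFs p).aestronglyMeasurable
  · exact (hFs p₀).intervalIntegrable _ _
  · exact (hFs' p₀).aestronglyMeasurable
  · refine Filter.Eventually.of_forall fun y hy p hp => ?_
    exact hC (p, y) ⟨hp.2, Set.uIoc_subset_uIcc hy⟩
  · exact intervalIntegrable_const
  · exact Filter.Eventually.of_forall fun y hy p hp => hd y (Set.uIoc_subset_uIcc hy) p hp.1

/-- Time derivative of a spatial integral. -/
lemma oh_time {G G' : ℝ → ℝ → ℝ}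
    (hG : ContinuousOn (fun p : ℝ × ℝ => G p.1 p.2) (Set.Ici (0:ℝ) ×ˢ (Set.univ : Set ℝ)))
    (hG' : ContinuousOn (fun p : ℝ × ℝ => G' p.1 p.2) (Set.Ici (0:ℝ) ×ˢ (Set.univ : Set ℝ)))
    (hd : ∀ t, 0 < t → ∀ x, HasDerivAt (fun s => G s x) (G' t x) t) :
    (∀ t, 0 < t → HasDerivAt (fun s => ∫ x in (0:ℝ)..1, G s x) (∫ x in (0:ℝ)..1, G' t x) t) ∧
    ContinuousOn (fun s => ∫ x in (0:ℝ)..1, G s x) (Set.Ici 0) := by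
  constructor
  · intro t ht
    have key := oh_param (F := fun t x => G (max t 0) x) (F' := fun t x => G' (max t 0) x)
      (p₀ := t) (a := 0) (b := 1) (s := Set.Ioi 0) (oh_ext hG) (oh_ext hG')
      (Ioi_mem_nhds ht) ?_
    · rw [max_eq_left ht.le] at key
      refine key.congr_of_eventuallyEq ?_
      filter_upwards [Ioi_mem_nhds ht] with s hs
      rw [max_eq_left (le_of_lt hs)]
    · intro y _ p hp
      have hp' : (0:ℝ) < p := hp
      rw [max_eq_left hp'.le]
      refine (hd p hp' y).congr_of_eventuallyEq ?_
      filter_upwards [Ioi_mem_nhds hp'] with s hs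
      rw [max_eq_left (le_of_lt hs)]
  · have h := intervalIntegral.continuous_parametric_intervalIntegral_of_continuous'
      (μ := MeasureTheory.volume) (f := fun t x => G (max t 0) x) (oh_ext hG) 0 1
    refine h.continuousOn.congr fun t ht => ?_
    have ht' : (0:ℝ) ≤ t := ht
    simp only [max_eq_left ht']

/-- Mixed partial derivatives. -/
lemma oh_mixed {γ : ℝ} {u : ℝ → ℝ → ℝ} (h : IsPeriodicOHSolution γ (Set.Ici 0) u)
    {t : ℝ} (ht : 0 < t) (x : ℝ) :
    HasDerivAt (fun s => deriv (u s) x) (deriv (fun y => deriv (fun s => u s y) t) x) t := by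
  have c1 := oh_ext (G := fun t x => deriv (fun s => u s x) t) h.cont_ut
  have c2 := oh_ext (G := fun t x => deriv (fun y => deriv (fun s => u s y) t) x) h.cont_utx
  have hsw : Continuous (fun p : ℝ × ℝ => ((p.2, p.1) : ℝ × ℝ)) := by fun_prop
  have c1x : ∀ x, Continuous (fun r : ℝ => deriv (fun s => u s x) (max r 0)) := fun x =>
    c1.comp (by fun_prop : Continuous fun r : ℝ => ((r, x) : ℝ × ℝ))
  have c2x : ∀ x, Continuous (fun r : ℝ => deriv (fun y => deriv (fun s => u s y) (max r 0)) x) :=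
    fun x => c2.comp (by fun_prop : Continuous fun r : ℝ => ((r, x) : ℝ × ℝ))
  have ftc : ∀ t, 0 ≤ t → ∀ x,
      u t x = u 0 x + ∫ r in (0:ℝ)..t, deriv (fun s => u s x) (max r 0) := by
    intro t ht x
    rw [intervalIntegral.integral_eq_sub_of_hasDerivAt (f := fun s => u s x)]
    · ring
    · intro r hr
      rw [Set.uIcc_of_le ht] at hr
      rw [max_eq_left hr.1]
      exact (h.diff_t r hr.1 x).hasDerivAt
    · exact (c1x x).intervalIntegrable _ _
  have vx : ∀ t, 0 ≤ t → deriv (u t) x = deriv (u 0) x +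
      ∫ r in (0:ℝ)..t, deriv (fun y => deriv (fun s => u s y) (max r 0)) x := by
    intro t ht
    have e : u t = fun x => u 0 x + ∫ r in (0:ℝ)..t, deriv (fun s => u s x) (max r 0) :=
      funext (ftc t ht)
    have k := oh_param (F := fun x r => deriv (fun s => u s x) (max r 0))
      (F' := fun x r => deriv (fun y => deriv (fun s => u s y) (max r 0)) x)
      (p₀ := x) (a := 0) (b := t) (s := Set.univ) (c1.comp hsw) (c2.comp hsw) Filter.univ_mem
      (fun y _ p _ => (h.diff_tx (max y 0) (Set.mem_Ici.2 (le_max_right _ _)) p).hasDerivAt)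
    have k2 := ((h.diff_x 0 (by simp) x).hasDerivAt.add k).deriv
    rw [e]
    exact k2
  have k3 := (intervalIntegral.integral_hasDerivAt_right ((c2x x).intervalIntegrable 0 t)
    ((c2x x).stronglyMeasurableAtFilter _ _) (c2x x).continuousAt).const_add (deriv (u 0) x)
  rw [max_eq_left ht.le] at k3
  refine k3.congr_of_eventuallyEq ?_
  filter_upwards [Ioi_mem_nhds ht] with s hs
  exact vx s (le_of_lt hs)

/-- Cauchy-Schwarz on `[0,1]`. -/
lemma oh_cs {f g : ℝ → ℝ} (hf : Continuous f) (hg : Continuous g) :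
    (∫ x in (0:ℝ)..1, f x * g x) ^ 2 ≤
      (∫ x in (0:ℝ)..1, f x ^ 2) * ∫ x in (0:ℝ)..1, g x ^ 2 := by
  have h : ∀ s : ℝ, 0 ≤ (∫ x in (0:ℝ)..1, f x ^ 2) * (s * s)
      + (2 * ∫ x in (0:ℝ)..1, f x * g x) * s + ∫ x in (0:ℝ)..1, g x ^ 2 := by
    intro s
    have h0 : 0 ≤ ∫ x in (0:ℝ)..1, (s * f x + g x) ^ 2 :=
      intervalIntegral.integral_nonneg (by norm_num) fun x _ => sq_nonneg _
    have e : (fun x => (s * f x + g x) ^ 2) =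
        fun x => ((s * s) * f x ^ 2 + (2 * s) * (f x * g x)) + g x ^ 2 := by
      funext x; ring
    rw [e, intervalIntegral.integral_add, intervalIntegral.integral_add,
      intervalIntegral.integral_const_mul, intervalIntegral.integral_const_mul] at h0
    · linarith
    all_goals exact Continuous.intervalIntegrable (by fun_prop) _ _
  have := discrim_le_zero h
  rw [discrim] at this
  nlinarith

/-- Blow-up of the scalar differential inequality. -/
lemma oh_ode {y D Q : ℝ → ℝ} {K t₁ : ℝ} (hK : 0 ≤ K) (hy0 : 0 < y t₁) (hyK : K ^ 3 < y t₁ ^ 2)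
    (hd : ∀ t, t₁ ≤ t → HasDerivAt y (D t) t) (hQ : ∀ t, 0 ≤ Q t)
    (hD : ∀ t, t₁ ≤ t → 2 * Q t ^ 2 - 2 * K * Q t ≤ D t)
    (hyQ : ∀ t, t₁ ≤ t → y t ^ 2 ≤ Q t ^ 3) : False := by
  set q := (y t₁) ^ ((2:ℝ)/3) with hq
  have hqpos : 0 < q := Real.rpow_pos_of_pos hy0 _
  have hq3 : q ^ 3 = y t₁ ^ 2 := by
    rw [hq, ← Real.rpow_natCast, ← Real.rpow_mul hy0.le, ← Real.rpow_natCast]; norm_num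
  have hKq : K < q := lt_of_pow_lt_pow_left₀ 3 hqpos.le (by rw [hq3]; exact hyK)
  have hQq : ∀ t, t₁ ≤ t → y t₁ ≤ y t → q ≤ Q t := by
    intro t ht hyt
    refine le_of_pow_le_pow_left₀ (n := 3) (by norm_num) (hQ t) ?_
    rw [hq3]
    exact le_trans (by gcongr) (hyQ t ht)
  have mono : ∀ t, t₁ ≤ t → y t₁ ≤ y t := by
    intro t ht
    have := image_le_of_deriv_right_lt_deriv_boundary (f := fun s => - y s) (f' := fun s => - D s)
      (a := t₁) (b := t) (B := fun _ => - y t₁) (B' := fun _ => 0)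
      (fun s hs => (hd s hs.1).neg.continuousAt.continuousWithinAt)
      (fun s hs => (hd s hs.1).neg.hasDerivWithinAt) le_rfl (fun s => hasDerivAt_const _ _)
      (by
        intro s hs hse
        have e : y s = y t₁ := by linarith
        have h1 := hQq s hs.1 e.ge
        have h2 := hD s hs.1
        nlinarith [mul_pos (lt_of_lt_of_le hqpos h1) (sub_pos.2 (lt_of_lt_of_le hKq h1))])
      (Set.right_mem_Icc.2 ht)
    simpa using this
  set c := 2 * (1 - K / q) with hc
  have hcpos : 0 < c := by
    have : K / q < 1 := (div_lt_one hqpos).2 hKq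
    linarith
  have hDc : ∀ t, t₁ ≤ t → c * Q t ^ 2 ≤ D t := by
    intro t ht
    have h1 := hQq t ht (mono t ht)
    have h2 := hD t ht
    have h3 : K ≤ K / q * Q t := by
      rw [div_mul_eq_mul_div, le_div_iff₀ hqpos]
      gcongr
    have h4 := mul_le_mul_of_nonneg_right h3 (hQ t)
    rw [hc]; nlinarith
  have hz : ∀ t, t₁ ≤ t → HasDerivAt (fun s => y s ^ (-(1:ℝ)/3) + (c / 3) * s)
      (D t * (-(1:ℝ)/3) * y t ^ (-(1:ℝ)/3 - 1) + (c / 3) * 1) t := by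
    intro t ht
    have hyt : 0 < y t := lt_of_lt_of_le hy0 (mono t ht)
    exact ((hd t ht).rpow_const (Or.inl hyt.ne')).add ((hasDerivAt_id t).const_mul (c/3))
  have hneg : ∀ t, t₁ ≤ t → D t * (-(1:ℝ)/3) * y t ^ (-(1:ℝ)/3 - 1) + (c / 3) * 1 ≤ 0 := by
    intro t ht
    have hyt : 0 < y t := lt_of_lt_of_le hy0 (mono t ht)
    have hw : 0 < y t ^ (-(1:ℝ)/3 - 1) := Real.rpow_pos_of_pos hyt _
    have hyQ' : y t ^ ((2:ℝ)/3) ≤ Q t := by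
      refine le_of_pow_le_pow_left₀ (n := 3) (by norm_num) (hQ t) ?_
      refine le_trans (le_of_eq ?_) (hyQ t ht)
      rw [← Real.rpow_natCast, ← Real.rpow_mul hyt.le, ← Real.rpow_natCast]; norm_num
    have h5 : (y t ^ ((2:ℝ)/3)) ^ 2 ≤ Q t ^ 2 := by gcongr
    have h6 : (y t ^ ((2:ℝ)/3)) ^ 2 * y t ^ (-(1:ℝ)/3 - 1) = 1 := by
      rw [← Real.rpow_natCast, ← Real.rpow_mul hyt.le, ← Real.rpow_add hyt]; norm_num
    have h7 := mul_le_mul_of_nonneg_right h5 hw.le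
    rw [h6] at h7
    have h8 := mul_le_mul_of_nonneg_right (hDc t ht) hw.le
    have h9 := mul_le_mul_of_nonneg_left h7 hcpos.le
    nlinarith
  have anti : AntitoneOn (fun s => y s ^ (-(1:ℝ)/3) + (c / 3) * s) (Set.Ici t₁) := by
    refine antitoneOn_of_deriv_nonpos (convex_Ici _) ?_ ?_ ?_
    · exact fun s hs => (hz s hs).continuousAt.continuousWithinAt
    · intro s hs
      rw [interior_Ici] at hs
      exact (hz s (le_of_lt hs)).differentiableAt.differentiableWithinAt
    · intro s hs
      rw [interior_Ici] at hs
      rw [(hz s (le_of_lt hs)).deriv]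
      exact hneg s (le_of_lt hs)
  set z := y t₁ ^ (-(1:ℝ)/3) with hzdef
  have hzp : 0 < z := Real.rpow_pos_of_pos hy0 _
  have hT : t₁ ≤ t₁ + 3 * z / c := by
    have : 0 < 3 * z / c := by positivity
    linarith
  have h1 := anti (Set.mem_Ici.2 le_rfl) (Set.mem_Ici.2 hT) hT
  have h2 : 0 < y (t₁ + 3 * z / c) ^ (-(1:ℝ)/3) :=
    Real.rpow_pos_of_pos (lt_of_lt_of_le hy0 (mono _ hT)) _
  have h3 : c / 3 * (t₁ + 3 * z / c) = c / 3 * t₁ + z := by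
    field_simp
  simp only [h3] at h1
  linarith

/-- Conservation of the `L²` norm. -/
lemma oh_energy {γ : ℝ} (hγ : 0 < γ) {u : ℝ → ℝ → ℝ}
    (h : IsPeriodicOHSolution γ (Set.Ici 0) u) {t : ℝ} (ht : 0 ≤ t) :
    (∫ x in (0:ℝ)..1, u t x ^ 2) = ∫ x in (0:ℝ)..1, u 0 x ^ 2 := by
  have cu := h.cont_u
  have cut := h.cont_ut
  obtain ⟨hd, hc⟩ := oh_time (G := fun t x => u t x ^ 2)
    (G' := fun t x => 2 * u t x * deriv (fun s => u s x) t)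
    (by fun_prop) ((continuousOn_const.mul cu).mul cut) (by
      intro t ht x
      exact ((h.diff_t t ht.le x).hasDerivAt.pow 2).congr_deriv (by norm_num))
  have zero : ∀ t, 0 < t → (∫ x in (0:ℝ)..1, 2 * u t x * deriv (fun s => u s x) t) = 0 := by
    intro t ht
    have su := oh_slice (G := u) h.cont_u ht.le
    have sut := oh_slice (G := fun t x => deriv (fun s => u s x) t) h.cont_ut ht.le
    have sux := oh_slice (G := fun t x => deriv (u t) x) h.cont_ux ht.le
    have pt : deriv (fun s => u s 1) t = deriv (fun s => u s 0) t := by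
      refine Filter.EventuallyEq.deriv_eq ?_
      filter_upwards [Ioi_mem_nhds ht] with s hs
      simpa using h.periodic s (Set.mem_Ici.2 (le_of_lt hs)) 0
    have pu : u t 1 = u t 0 := by simpa using h.periodic t ht.le 0
    have px : deriv (u t) 1 = deriv (u t) 0 := by
      have e : (fun x => u t (x + 1)) = u t := funext (h.periodic t ht.le)
      have := deriv_comp_add_const (u t) 1 0
      rw [e] at this
      simpa using this.symm
    have key := intervalIntegral.integral_eq_sub_of_hasDerivAt (a := 0) (b := 1)
      (f := fun x => (deriv (fun s => u s x) t + u t x * deriv (u t) x) ^ 2 / γ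
        - 2 / 3 * u t x ^ 3)
      (f' := fun x => 2 * u t x * deriv (fun s => u s x) t) (by
        intro x _
        have a1 := (h.diff_x t ht.le x).hasDerivAt
        have a2 := (h.diff_xx t ht.le x).hasDerivAt
        have a3 := (h.diff_tx t ht.le x).hasDerivAt
        have e := h.eqn t ht.le ht x
        refine ((((a3.add (a1.mul a2)).pow 2).div_const γ).sub
          ((a1.pow 3).const_mul (2/3))).congr_deriv ?_
        have e2 : deriv (fun y => deriv (fun s => u s y) t) x + (deriv (u t) x * deriv (u t) x +
          u t x * deriv (deriv (u t)) x) = γ * u t x := by rw [← e]; ring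
        rw [e2]
        simp only [Pi.add_apply, Pi.mul_apply]
        field_simp
        push_cast
        ring)
      (Continuous.intervalIntegrable (by fun_prop) _ _)
    rw [key]
    simp only [pt, pu, px]
    ring
  rcases ht.eq_or_lt with rfl | ht
  · rfl
  have hdd : DifferentiableOn ℝ (fun s => ∫ x in (0:ℝ)..1, u s x ^ 2) (interior (Set.Ici 0)) := by
    intro s hs
    rw [interior_Ici] at hs
    exact (hd s hs).differentiableAt.differentiableWithinAt
  have hdz : ∀ s ∈ interior (Set.Ici (0:ℝ)), deriv (fun s => ∫ x in (0:ℝ)..1, u s x ^ 2) s = 0 := by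
    intro s hs
    rw [interior_Ici] at hs
    rw [(hd s hs).deriv, zero s hs]
  have m1 := antitoneOn_of_deriv_nonpos (convex_Ici 0) hc hdd (fun s hs => (hdz s hs).le)
  have m2 := monotoneOn_of_deriv_nonneg (convex_Ici 0) hc hdd (fun s hs => (hdz s hs).ge)
  have h0 : (0:ℝ) ∈ Set.Ici (0:ℝ) := Set.mem_Ici.2 le_rfl
  exact le_antisymm (m1 h0 (Set.mem_Ici.2 ht.le) ht.le) (m2 h0 (Set.mem_Ici.2 ht.le) ht.le)

lemma oh_main {γ : ℝ} {u : ℝ → ℝ → ℝ}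
    (h : IsPeriodicOHSolution γ (Set.Ici 0) u) {t : ℝ} (ht : 0 < t) :
    (∫ x in (0:ℝ)..1, 3 * deriv (u t) x ^ 2 * deriv (fun y => deriv (fun s => u s y) t) x)
      = 3 * γ * (∫ x in (0:ℝ)..1, u t x * deriv (u t) x ^ 2)
        - 2 * ∫ x in (0:ℝ)..1, (deriv (u t) x ^ 2) ^ 2 := by
  have su := oh_slice (G := u) h.cont_u ht.le
  have sux := oh_slice (G := fun t x => deriv (u t) x) h.cont_ux ht.le
  have suxx := oh_slice (G := fun t x => deriv (deriv (u t)) x) h.cont_uxx ht.le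
  have pu : u t 1 = u t 0 := by simpa using h.periodic t ht.le 0
  have px : deriv (u t) 1 = deriv (u t) 0 := by
    have e : (fun x => u t (x + 1)) = u t := funext (h.periodic t ht.le)
    have := deriv_comp_add_const (u t) 1 0
    rw [e] at this
    simpa using this.symm
  have key := intervalIntegral.integral_eq_sub_of_hasDerivAt (a := 0) (b := 1)
    (f := fun x => u t x * deriv (u t) x ^ 3)
    (f' := fun x => (deriv (u t) x ^ 2) ^ 2 + u t x * (3 * deriv (u t) x ^ 2 * deriv (deriv (u t)) x))
    (by
      intro x _
      have a1 := (h.diff_x t ht.le x).hasDerivAt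
      have a2 := (h.diff_xx t ht.le x).hasDerivAt
      refine (a1.mul (a2.pow 3)).congr_deriv ?_
      simp only [Pi.pow_apply]
      push_cast
      ring)
    (Continuous.intervalIntegrable (by fun_prop) _ _)
  simp only [pu, px, sub_self] at key
  have e : (fun x => 3 * deriv (u t) x ^ 2 * deriv (fun y => deriv (fun s => u s y) t) x) =
      fun x => (3 * γ * (u t x * deriv (u t) x ^ 2) - 2 * (deriv (u t) x ^ 2) ^ 2) -
        ((deriv (u t) x ^ 2) ^ 2 + u t x * (3 * deriv (u t) x ^ 2 * deriv (deriv (u t)) x)) := by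
    funext x
    have e := h.eqn t ht.le ht x
    have e2 : deriv (fun y => deriv (fun s => u s y) t) x =
      γ * u t x - deriv (u t) x ^ 2 - u t x * deriv (deriv (u t)) x := by linarith
    rw [e2]; ring
  rw [e, intervalIntegral.integral_sub, key, intervalIntegral.integral_sub,
    intervalIntegral.integral_const_mul, intervalIntegral.integral_const_mul, sub_zero]
  all_goals exact Continuous.intervalIntegrable (by fun_prop) _ _

/-- if `∫₀¹ (u₀')³ < -((3γ/2)‖u₀‖_{L²})^{3/2}`, then no periodic classical
solution with initial data `u₀` and `u_x` bounded from below exists globally in time,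
i.e. every such solution on `[0,T)` has `T < ∞`. -/
theorem wave_breaking_first_criterion
    (γ : ℝ) (hγ : 0 < γ) (u₀ : ℝ → ℝ) (hreg : ContDiff ℝ 2 u₀)
    (hper : ∀ x : ℝ, u₀ (x + 1) = u₀ x)
    (hmean : (∫ x in (0:ℝ)..1, u₀ x) = 0)
    (hcond : (∫ x in (0:ℝ)..1, (deriv u₀ x) ^ 3)
      < -((3 * γ / 2) * Real.sqrt (∫ x in (0:ℝ)..1, (u₀ x) ^ 2)) ^ ((3:ℝ)/2)) :
    ∀ u : ℝ → ℝ → ℝ,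
      IsPeriodicOHSolution γ (Set.Ici 0) u →
      u 0 = u₀ →
      ¬ ∃ c : ℝ, ∀ t ∈ Set.Ici (0 : ℝ), ∀ x : ℝ, c ≤ deriv (u t) x := by
  rintro u h rfl -
  set E := ∫ x in (0:ℝ)..1, u 0 x ^ 2 with hE
  set K := 3 * γ / 2 * Real.sqrt E with hK
  have hK0 : 0 ≤ K := by positivity
  have cux := h.cont_ux
  obtain ⟨hd, hc⟩ := oh_time (G := fun t x => deriv (u t) x ^ 3)
    (G' := fun t x => 3 * deriv (u t) x ^ 2 * deriv (fun y => deriv (fun s => u s y) t) x)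
    (cux.pow 3) ((continuousOn_const.mul (cux.pow 2)).mul h.cont_utx) (by
      intro t ht x
      exact ((oh_mixed h ht x).pow 3).congr_deriv (by norm_num))
  obtain ⟨t₁, ht₁, hV⟩ : ∃ t₁ : ℝ, 0 < t₁ ∧
      (∫ x in (0:ℝ)..1, deriv (u t₁) x ^ 3) < - K ^ ((3:ℝ)/2) := by
    have c0 := (hc 0 (by simp)).mono (Set.Ioi_subset_Ici_self)
    have ev := c0.eventually (gt_mem_nhds hcond)
    obtain ⟨t, h1, h2⟩ := (ev.and self_mem_nhdsWithin).exists
    exact ⟨t, h2, h1⟩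
  have hKp : 0 ≤ K ^ ((3:ℝ)/2) := Real.rpow_nonneg hK0 _
  have hKs : (K ^ ((3:ℝ)/2)) ^ 2 = K ^ 3 := by
    rw [← Real.rpow_natCast, ← Real.rpow_mul hK0, ← Real.rpow_natCast]; norm_num
  refine oh_ode (y := fun t => - ∫ x in (0:ℝ)..1, deriv (u t) x ^ 3)
    (D := fun t => - ∫ x in (0:ℝ)..1,
      3 * deriv (u t) x ^ 2 * deriv (fun y => deriv (fun s => u s y) t) x)
    (Q := fun t => Real.sqrt (∫ x in (0:ℝ)..1, (deriv (u t) x ^ 2) ^ 2)) (K := K) (t₁ := t₁)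
    hK0 (by linarith) ?_ (fun t ht => (hd t (lt_of_lt_of_le ht₁ ht)).neg)
    (fun t => Real.sqrt_nonneg _) ?_ ?_
  · rw [← hKs]
    have : K ^ ((3:ℝ)/2) < - ∫ x in (0:ℝ)..1, deriv (u t₁) x ^ 3 := by linarith
    exact pow_lt_pow_left₀ this hKp (by norm_num)
  · intro t ht
    have ht0 : 0 < t := lt_of_lt_of_le ht₁ ht
    have su := oh_slice (G := u) h.cont_u ht0.le
    have sux := oh_slice (G := fun t x => deriv (u t) x) h.cont_ux ht0.le
    have cs := oh_cs su (sux.pow 2)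
    simp only [Pi.pow_apply] at cs
    rw [oh_energy hγ h ht0.le, ← hE] at cs
    simp only [oh_main h ht0]
    have hP : 0 ≤ ∫ x in (0:ℝ)..1, (deriv (u t) x ^ 2) ^ 2 :=
      intervalIntegral.integral_nonneg (by norm_num) fun x _ => sq_nonneg _
    have hE0 : 0 ≤ E :=
      intervalIntegral.integral_nonneg (by norm_num) fun x _ => sq_nonneg _
    have cs2 := Real.le_sqrt_of_sq_le cs
    rw [Real.sqrt_mul hE0] at cs2
    rw [Real.sq_sqrt hP, hK]
    have := mul_le_mul_of_nonneg_left cs2 (by positivity : 0 ≤ 3 * γ)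
    linarith
  · intro t ht
    have ht0 : 0 < t := lt_of_lt_of_le ht₁ ht
    have sux := oh_slice (G := fun t x => deriv (u t) x) h.cont_ux ht0.le
    have hP : 0 ≤ ∫ x in (0:ℝ)..1, (deriv (u t) x ^ 2) ^ 2 :=
      intervalIntegral.integral_nonneg (by norm_num) fun x _ => sq_nonneg _
    have hR : 0 ≤ ∫ x in (0:ℝ)..1, deriv (u t) x ^ 2 :=
      intervalIntegral.integral_nonneg (by norm_num) fun x _ => sq_nonneg _
    have cs1 := oh_cs sux (sux.pow 2)
    have cs2 := oh_cs (continuous_const (y := (1:ℝ))) (sux.pow 2)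
    have e1 : (fun x => deriv (u t) x * deriv (u t) x ^ 2) = fun x => deriv (u t) x ^ 3 := by
      funext x; ring
    simp only [Pi.pow_apply] at cs1 cs2
    rw [e1] at cs1
    simp only [one_mul, one_pow, intervalIntegral.integral_const, sub_zero, smul_eq_mul] at cs2
    have cs3 := Real.le_sqrt_of_sq_le cs2
    simp only [neg_sq]
    set P := ∫ x in (0:ℝ)..1, (deriv (u t) x ^ 2) ^ 2 with hPdef
    have e3 : Real.sqrt P ^ 3 = Real.sqrt P * P := by
      rw [pow_succ, Real.sq_sqrt hP]; ring
    rw [e3]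
    exact cs1.trans (mul_le_mul_of_nonneg_right cs3 hP)
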